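/- For a nonnegative integer n and complex parameters a, b, c, d, e, f, p, q with d+e+f−a−b−c+n = 3, (c−q)(d−a−b−1) ≠ 0, and nondegenerate parameters, define F̃_n(a,b,c; d,e,f; p,q) = (d)_n (e)_n (f)_n (α)_n · ₆F₅(a, b, c, p+1, q+1, −n; d, e, f, p, q; 1), where α = q(e−c−1)(f−c−1)/((c−q)(d−a−b−1)). Then, with γ = p(d−a−1)(d−b−1)/(ab + p(d−a−b−1)) and δ = (q(e−c−1)(f−c−1) + n(c−q)(d−a−b−1))/((e−c−1)(f−c−1) − (c−q)(d−a−b−1)) (assuming these fractions have nonzero denominators and the transformed parameter set, which automatically satisfies the same Saalschütz-type condition, is nondegenerate), one has F̃_n(a,b,c; d,e,f; p,q) = (−1)^n F̃_n(d−a−1, d−b−1, c; d, 2+c−e−n, 2+c−f−n; γ, δ). -/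

import Mathlib

/-- Rising factorial (Pochhammer symbol) `(a)ₖ = a(a+1)⋯(a+k−1)`. -/
noncomputable def poch (a : ℂ) (k : ℕ) : ℂ := (ascPochhammer ℂ k).eval a

/-- Terminating hypergeometric sum with numerator parameters `A` together with
the extra top parameter `-n`, denominator parameters `B`, and argument `x`. -/
noncomputable def hypTerm (A B : List ℂ) (n : ℕ) (x : ℂ) : ℂ :=
  ∑ k ∈ Finset.range (n + 1),
    ((A.map fun a => poch a k).prod * poch (-(n : ℂ)) k) /
      ((k.factorial : ℂ) * (B.map fun b => poch b k).prod) * x ^ k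

/-- The normalized Saalschützian series `F̃ₙ(a,b,c;d,e,f;p,q)` of Remark 4.3, with
`α = q(e−c−1)(f−c−1)/((c−q)(d−a−b−1))`. -/
noncomputable def Ftilde (n : ℕ) (a b c d e f p q : ℂ) : ℂ :=
  poch d n * poch e n * poch f n *
    poch (q * (e - c - 1) * (f - c - 1) / ((c - q) * (d - a - b - 1))) n *
    hypTerm [a, b, c, p + 1, q + 1] [d, e, f, p, q] n 1

section SaalschutzTransform

open Finset

theorem poch_zero (a : ℂ) : poch a 0 = 1 := by simp [poch]

theorem poch_succ (a : ℂ) (k : ℕ) : poch a (k + 1) = poch a k * (a + k) := by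
  simp [poch, ascPochhammer_succ_eval]

theorem poch_add (a : ℂ) (j k : ℕ) : poch a (j + k) = poch a j * poch (a + j) k := by
  induction k with
  | zero => simp [poch_zero]
  | succ k ih =>
    rw [← add_assoc, poch_succ, ih, poch_succ]
    push_cast
    ring

theorem poch_succ_left (a : ℂ) (k : ℕ) : poch a (k + 1) = a * poch (a + 1) k := by
  rw [add_comm, poch_add, poch_succ, poch_zero]
  simp

theorem poch_reflect (a : ℂ) (k : ℕ) : poch (1 - a - k) k = (-1) ^ k * poch a k := by
  induction k with
  | zero => simp [poch_zero]
  | succ k ih =>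
    rw [poch_succ_left, poch_succ, pow_succ,
      show (1 - a - ((k + 1 : ℕ) : ℂ) + 1) = 1 - a - k by push_cast; ring, ih]
    push_cast
    ring

theorem poch_neg_natCast {N m : ℕ} (h : m ≤ N) :
    poch (-(N : ℂ)) m = (-1) ^ m * (m.factorial * N.choose m) := by
  induction m with
  | zero => simp [poch_zero]
  | succ m ih =>
    have hc : (N.choose (m + 1) : ℂ) * (m + 1) = N.choose m * (N - m) := by
      have := Nat.choose_succ_right_eq N m
      rw [← Nat.cast_sub (by omega : m ≤ N)]
      exact_mod_cast this
    rw [poch_succ, ih (by omega), Nat.factorial_succ, pow_succ]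
    push_cast
    linear_combination (-1) ^ m * (m.factorial : ℂ) * hc

theorem sum_antidiagonal_choose_of_fst {F g : ℕ → ℕ → ℂ} (N : ℕ) (h0 : ∀ j, F 0 j = 0)
    (hF : ∀ i j, F (i + 1) j = (i + 1) * g i j) :
    ∑ ij ∈ antidiagonal (N + 1), ((N + 1).choose ij.1 : ℂ) * F ij.1 ij.2 =
      (N + 1) * ∑ ij ∈ antidiagonal N, (N.choose ij.1 : ℂ) * g ij.1 ij.2 := by
  rw [Nat.sum_antidiagonal_succ, h0, mul_zero, zero_add, mul_sum]
  refine sum_congr rfl fun ij _ => ?_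
  have : ((N + 1).choose (ij.1 + 1) : ℂ) * (ij.1 + 1) = (N + 1) * N.choose ij.1 := by
    exact_mod_cast (Nat.add_one_mul_choose_eq N ij.1).symm
  rw [hF]
  linear_combination g ij.1 ij.2 * this

theorem sum_antidiagonal_choose_of_snd {F g : ℕ → ℕ → ℂ} (N : ℕ) (h0 : ∀ i, F i 0 = 0)
    (hF : ∀ i j, F i (j + 1) = (j + 1) * g i j) :
    ∑ ij ∈ antidiagonal (N + 1), ((N + 1).choose ij.1 : ℂ) * F ij.1 ij.2 =
      (N + 1) * ∑ ij ∈ antidiagonal N, (N.choose ij.1 : ℂ) * g ij.1 ij.2 := by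
  have key := sum_antidiagonal_choose_of_fst (F := fun i j => F j i) (g := fun i j => g j i) N
    h0 fun i j => hF j i
  rw [← Nat.sum_antidiagonal_swap, ← Nat.sum_antidiagonal_swap (n := N)]
  refine Eq.trans (sum_congr rfl fun ij hij => ?_)
    (key.trans (congrArg _ (sum_congr rfl fun ij hij => ?_)))
  · rw [Prod.fst_swap, Prod.snd_swap, Nat.choose_symm_of_eq_add (mem_antidiagonal.1 hij).symm]
  · rw [Prod.fst_swap, Prod.snd_swap, Nat.choose_symm_of_eq_add (mem_antidiagonal.1 hij).symm]

/-- The Saalschütz sum with denominators cleared; balanced when `A + B + M = D`. -/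
noncomputable def saalSum (N : ℕ) (A B D M : ℂ) : ℂ :=
  ∑ ij ∈ antidiagonal N, (N.choose ij.1 : ℂ) *
    (poch A ij.1 * poch B ij.1 * poch (D + ij.1) ij.2 * poch M ij.2)

theorem saalSum_sub_one (N : ℕ) (A B D M : ℂ) :
    saalSum (N + 1) A B D (M - 1) =
      saalSum (N + 1) A B D M - (N + 1) * (D + N) * saalSum N A B D M := by
  have key := sum_antidiagonal_choose_of_snd
    (F := fun i j => poch A i * poch B i * poch (D + i) j * (poch M j - poch (M - 1) j))
    (g := fun i j => poch A i * poch B i * poch (D + i) (j + 1) * poch M j) N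
    (fun i => by simp [poch_zero]) fun i j => by
      rw [poch_succ M, poch_succ_left (M - 1), sub_add_cancel]
      ring
  have hg : ∑ ij ∈ antidiagonal N, (N.choose ij.1 : ℂ) *
      (poch A ij.1 * poch B ij.1 * poch (D + ij.1) (ij.2 + 1) * poch M ij.2) =
      (D + N) * saalSum N A B D M := by
    rw [saalSum, mul_sum]
    refine sum_congr rfl fun ij hij => ?_
    rw [← mem_antidiagonal.1 hij, poch_succ]
    push_cast
    ring
  simp only [mul_sub, sum_sub_distrib] at key
  rw [hg] at key
  rw [mul_assoc, ← key]
  simp only [saalSum]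
  ring

theorem mul_saalSum_add_one (N : ℕ) (A B D M : ℂ) :
    A * saalSum N (A + 1) B D M = ∑ ij ∈ antidiagonal N, (N.choose ij.1 : ℂ) *
      (poch A ij.1 * poch B ij.1 * poch (D + ij.1) ij.2 * poch M ij.2 * (A + ij.1)) := by
  rw [saalSum, mul_sum]
  refine sum_congr rfl fun ij _ => ?_
  have : A * poch (A + 1) ij.1 = poch A ij.1 * (A + ij.1) := by
    rw [← poch_succ_left, poch_succ]
  linear_combination
    (N.choose ij.1 : ℂ) * (poch B ij.1 * poch (D + ij.1) ij.2 * poch M ij.2) * this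

theorem saalSum_succ (N : ℕ) (A B D M : ℂ) (h : A + B + M = D) :
    saalSum (N + 1) A B D M = N * (A * saalSum N (A + 1) B (D + 1) M) +
      (D - A) * (D - B + N) * saalSum N A B (D + 1) M := by
  rw [mul_saalSum_add_one, saalSum, saalSum, mul_sum, mul_sum, ← sum_add_distrib,
    sum_antidiagonal_choose_succ_mul
      (fun i j => poch A i * poch B i * poch (D + i) j * poch M j), ← sum_add_distrib]
  refine sum_congr rfl fun ij hij => ?_
  have hN : (N : ℂ) = ij.1 + ij.2 := by exact_mod_cast (mem_antidiagonal.1 hij).symm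
  rw [← Nat.choose_symm_of_eq_add (mem_antidiagonal.1 hij).symm, poch_succ_left (D + ij.1),
    poch_succ A, poch_succ B, poch_succ M, hN,
    show D + ((ij.1 + 1 : ℕ) : ℂ) = D + 1 + ij.1 by push_cast; ring,
    show D + (ij.1 : ℂ) + 1 = D + 1 + ij.1 by ring]
  subst h
  ring

/-- The Pfaff–Saalschütz summation with denominators cleared. -/
theorem saalSum_balanced (N : ℕ) (A B D M : ℂ) (h : A + B + M = D) :
    saalSum N A B D M = poch (D - A) N * poch (D - B) N := by
  induction N using Nat.strong_induction_on generalizing A B D M with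
  | _ N ih =>
    match N with
    | 0 => simp [saalSum, poch_zero]
    | 1 =>
      rw [saalSum_succ 0 A B D M h]
      simp [saalSum, poch_zero, poch_succ]
    | N + 2 =>
      have h2 := saalSum_sub_one N A B (D + 1) (M + 1)
      rw [add_sub_cancel_right] at h2
      rw [saalSum_succ _ A B D M h, h2,
        ih (N + 1) (by omega) (A + 1) B (D + 1) M (by rw [← h]; ring),
        ih (N + 1) (by omega) A B (D + 1) (M + 1) (by rw [← h]; ring),
        ih N (by omega) A B (D + 1) (M + 1) (by rw [← h]; ring)]
      have e1 : D + 1 - (A + 1) = D - A := by ring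
      have e2 : D + 1 - A = D - A + 1 := by ring
      have e3 : D + 1 - B = D - B + 1 := by ring
      rw [e1, e2, e3, poch_succ (D - A) (N + 1), poch_succ_left (D - A) N,
        poch_succ_left (D - B) (N + 1), poch_succ (D - A + 1) N, poch_succ (D - B + 1) N]
      push_cast
      ring

/-- The Saalschütz summation extended by a linear weight. -/
theorem sum_linear_saal (N : ℕ) (A B D s u v : ℂ) (h : A + B + s + 1 = D) :
    (D - A - 1) * (D - B - 1) * ∑ ij ∈ antidiagonal N, (N.choose ij.1 : ℂ) *
      (poch A ij.1 * poch B ij.1 * poch (D + ij.1) ij.2 * poch s ij.2 * (u + v * ij.1)) =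
    poch (D - A - 1) N * poch (D - B - 1) N *
      (u * ((D - A - 1) * (D - B - 1) + N * s) + N * v * (A * B)) := by
  match N with
  | 0 => simp [poch_zero]; ring
  | N + 1 =>
    have key := sum_antidiagonal_choose_of_fst
      (F := fun i j => poch A i * poch B i * poch (D + i) j * poch s j * i)
      (g := fun i j => A * B *
        (poch (A + 1) i * poch (B + 1) i * poch (D + 1 + i) j * poch s j)) N
      (fun j => by simp) fun i j => by
        rw [poch_succ_left, poch_succ_left, show D + 1 + (i : ℂ) = D + ((i + 1 : ℕ) : ℂ) by
          push_cast; ring]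
        push_cast
        ring
    have h1 : ∑ ij ∈ antidiagonal N, (N.choose ij.1 : ℂ) * (A * B *
        (poch (A + 1) ij.1 * poch (B + 1) ij.1 * poch (D + 1 + ij.1) ij.2 * poch s ij.2)) =
        A * B * saalSum N (A + 1) (B + 1) (D + 1) s := by
      rw [saalSum, mul_sum]
      exact sum_congr rfl fun ij _ => by ring
    have h2 := saalSum_sub_one N A B D (s + 1)
    rw [add_sub_cancel_right, saalSum_balanced _ A B D (s + 1) (by rw [← h]; ring),
      saalSum_balanced _ A B D (s + 1) (by rw [← h]; ring)] at h2
    rw [h1, saalSum_balanced _ _ _ _ _ (by rw [← h]; ring)] at key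
    have h3 : ∑ ij ∈ antidiagonal (N + 1), ((N + 1).choose ij.1 : ℂ) *
        (poch A ij.1 * poch B ij.1 * poch (D + ij.1) ij.2 * poch s ij.2 * (u + v * ij.1)) =
        u * saalSum (N + 1) A B D s + v * ∑ ij ∈ antidiagonal (N + 1), ((N + 1).choose ij.1 : ℂ) *
        (poch A ij.1 * poch B ij.1 * poch (D + ij.1) ij.2 * poch s ij.2 * ij.1) := by
      rw [saalSum, mul_sum, mul_sum, ← sum_add_distrib]
      exact sum_congr rfl fun ij _ => by ring
    rw [h3, key, h2, show D + 1 - (A + 1) = D - A by ring, show D + 1 - (B + 1) = D - B by ring,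
      poch_succ_left (D - A - 1), poch_succ_left (D - B - 1), sub_add_cancel, sub_add_cancel,
      poch_succ, poch_succ]
    obtain rfl : s = D - A - B - 1 := by rw [← h]; ring
    push_cast
    ring

/-- Expansion coefficients of Euler's transformation of a `₃F₂(a, b, p + 1; d, p)`. -/
theorem euler_coeff (k : ℕ) (a b d s p : ℂ) (h : a + b + s + 1 = d)
    (hd : ∀ i ≤ k, poch d i ≠ 0) :
    poch (d - a - 1) k * poch (d - b - 1) k *
        (p * ((d - a - 1) * (d - b - 1)) + k * (a * b + p * s)) / (k.factorial * poch d k) =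
      (d - a - 1) * (d - b - 1) * ∑ i ∈ range (k + 1),
        poch a i * poch b i * (p + i) / (i.factorial * poch d i) *
          (poch s (k - i) / (k - i).factorial) := by
  rw [← Nat.sum_antidiagonal_eq_sum_range_succ
    (fun i j => poch a i * poch b i * (p + i) / (i.factorial * poch d i) *
      (poch s j / j.factorial))]
  have hk : (k.factorial : ℂ) ≠ 0 := by exact_mod_cast k.factorial_ne_zero
  have hdk := hd k le_rfl
  have key := sum_linear_saal k a b d s p 1 h
  have hs : ∑ ij ∈ antidiagonal k, (k.choose ij.1 : ℂ) *
      (poch a ij.1 * poch b ij.1 * poch (d + ij.1) ij.2 * poch s ij.2 * (p + 1 * ij.1)) =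
      k.factorial * poch d k * ∑ ij ∈ antidiagonal k,
        poch a ij.1 * poch b ij.1 * (p + ij.1) / (ij.1.factorial * poch d ij.1) *
          (poch s ij.2 / ij.2.factorial) := by
    rw [mul_sum]
    refine sum_congr rfl fun ij hij => ?_
    have hij' := mem_antidiagonal.1 hij
    have h1 : ((ij.1.factorial : ℂ)) ≠ 0 := by exact_mod_cast ij.1.factorial_ne_zero
    have h2 : ((ij.2.factorial : ℂ)) ≠ 0 := by exact_mod_cast ij.2.factorial_ne_zero
    have h3 := hd ij.1 (by omega)
    have h4 : (k.factorial : ℂ) = k.choose ij.1 * ij.1.factorial * ij.2.factorial := by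
      rw [← hij', Nat.choose_symm_add]
      exact_mod_cast (Nat.add_choose_mul_factorial_mul_factorial ij.1 ij.2).symm
    have h5 : poch d k = poch d ij.1 * poch (d + ij.1) ij.2 := by rw [← poch_add, hij']
    rw [h4, h5]
    field_simp
  rw [hs] at key
  rw [div_eq_iff (mul_ne_zero hk hdk)]
  linear_combination -key

/-- The extended Saalschütz summation, read backwards from the top index. -/
theorem sum_reversed_saal (j N n : ℕ) (c e f q s : ℂ) (hn : j + N = n)
    (hs : e + f + s + n = c + 2) (he : 1 - e - n ≠ 0) (hf : 1 - f - n ≠ 0) :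
    ∑ m ∈ range (N + 1), poch s m / m.factorial *
      (poch c (j + m) * poch (-(n : ℂ)) (j + m) *
        (q * ((e - c - 1) * (f - c - 1)) + n * ((c - q) * s) +
          (j + m : ℕ) * ((e - c - 1) * (f - c - 1) - (c - q) * s)) *
        (poch (e - c - 1) (n - (j + m)) * poch (f - c - 1) (n - (j + m)))) =
    (e - c - 1) * (f - c - 1) * (poch c j * poch (-(n : ℂ)) j * (q + j) *
      (poch (e + j) N * poch (f + j) N)) := by
  set A := (e - c - 1) * (f - c - 1) with hA
  set B := (c - q) * s with hB
  have hnC : (n : ℂ) = j + N := by exact_mod_cast hn.symm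
  have key := sum_linear_saal N (e - c - 1) (f - c - 1) (1 - c - n) s ((q + n) * A) (-(A - B))
    (by linear_combination hs)
  have hx : 1 - c - n - (e - c - 1) - 1 = 1 - (e + j) - N := by rw [hnC]; ring
  have hy : 1 - c - n - (f - c - 1) - 1 = 1 - (f + j) - N := by rw [hnC]; ring
  have hx0 : 1 - (e + j) - (N : ℂ) ≠ 0 := by convert he using 1; rw [hnC]; ring
  have hy0 : 1 - (f + j) - (N : ℂ) ≠ 0 := by convert hf using 1; rw [hnC]; ring
  have hxy : (1 - (e + j) - (N : ℂ)) * (1 - (f + j) - N) = A - (c + n) * s := by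
    have : f = c + 2 - e - s - n := by linear_combination hs
    rw [hA, this, hnC]
    ring
  have hsign : ((-1 : ℂ) ^ N) * (-1) ^ N = 1 := by rw [← mul_pow]; simp
  rw [hx, hy, poch_reflect, poch_reflect] at key
  have hsum : ∑ m ∈ range (N + 1), poch s m / m.factorial *
      (poch c (j + m) * poch (-(n : ℂ)) (j + m) * (q * A + n * B + (j + m : ℕ) * (A - B)) *
        (poch (e - c - 1) (n - (j + m)) * poch (f - c - 1) (n - (j + m)))) =
      poch c j * poch (-(n : ℂ)) j * ∑ im ∈ antidiagonal N, (N.choose im.1 : ℂ) *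
        (poch (e - c - 1) im.1 * poch (f - c - 1) im.1 * poch (1 - c - n + im.1) im.2 *
          poch s im.2 * ((q + n) * A + -(A - B) * im.1)) := by
    rw [← Nat.sum_antidiagonal_swap, Nat.sum_antidiagonal_eq_sum_range_succ_mk, mul_sum]
    refine sum_congr rfl fun m hm => ?_
    have hmN : m ≤ N := Nat.lt_succ_iff.1 (mem_range.1 hm)
    have hm0 : (m.factorial : ℂ) ≠ 0 := by exact_mod_cast m.factorial_ne_zero
    have hi : n - (j + m) = N - m := by omega
    have hiC : ((N - m : ℕ) : ℂ) = N - m := Nat.cast_sub hmN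
    have hD : poch (1 - c - n + ((N - m : ℕ) : ℂ)) m = (-1) ^ m * poch (c + j) m := by
      rw [← poch_reflect]
      congr 1
      rw [hiC, hnC]
      ring
    have hneg : -(n : ℂ) + j = -(N : ℂ) := by rw [hnC]; ring
    simp only [Prod.swap_prod_mk]
    rw [hi, hD, poch_add c, poch_add (-(n : ℂ)), hneg, poch_neg_natCast hmN, Nat.choose_symm hmN,
      hiC, hnC]
    push_cast
    field_simp
    ring
  rw [hsum]
  refine mul_left_cancel₀ (mul_ne_zero hx0 hy0) ?_
  linear_combination poch c j * poch (-(n : ℂ)) j * key +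
    poch c j * poch (-(n : ℂ)) j * poch (e + j) N * poch (f + j) N *
      (((q + n) * A * ((1 - (e + j) - (N : ℂ)) * (1 - (f + j) - N) + N * s) -
        N * (A - B) * A) * hsign + N * A * hxy +
        A * ((1 - (e + j) - (N : ℂ)) * (1 - (f + j) - N)) * hnC)

/-- Euler's transformation applied termwise to the Saalschützian sum, denominators cleared. -/
theorem sum_euler_transform (n : ℕ) (a b c d e f p q s : ℂ) (hd : ∀ k ≤ n, poch d k ≠ 0)
    (hs : a + b + s + 1 = d) (hef : e + f + s + n = c + 2) (he : 1 - e - n ≠ 0)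
    (hf : 1 - f - n ≠ 0) :
    ∑ k ∈ range (n + 1),
      poch (d - a - 1) k * poch (d - b - 1) k *
        (p * ((d - a - 1) * (d - b - 1)) + k * (a * b + p * s)) / (k.factorial * poch d k) *
      (poch c k * poch (-(n : ℂ)) k *
        (q * ((e - c - 1) * (f - c - 1)) + n * ((c - q) * s) +
          k * ((e - c - 1) * (f - c - 1) - (c - q) * s)) *
        (poch (e - c - 1) (n - k) * poch (f - c - 1) (n - k))) =
    (d - a - 1) * (d - b - 1) * ((e - c - 1) * (f - c - 1)) *
      ∑ k ∈ range (n + 1), poch a k * poch b k * (p + k) / (k.factorial * poch d k) *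
        (poch c k * poch (-(n : ℂ)) k * (q + k) *
          (poch (e + k) (n - k) * poch (f + k) (n - k))) := by
  set v : ℕ → ℂ := fun k => poch c k * poch (-(n : ℂ)) k *
        (q * ((e - c - 1) * (f - c - 1)) + n * ((c - q) * s) +
          k * ((e - c - 1) * (f - c - 1) - (c - q) * s)) *
        (poch (e - c - 1) (n - k) * poch (f - c - 1) (n - k)) with hv
  set u : ℕ → ℂ := fun k => poch a k * poch b k * (p + k) / (k.factorial * poch d k) with hu
  calc _ = (d - a - 1) * (d - b - 1) * ∑ k ∈ range (n + 1), ∑ i ∈ range (k + 1),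
        u i * (poch s (k - i) / (k - i).factorial) * v (i + (k - i)) := by
        rw [mul_sum]
        refine sum_congr rfl fun k hk => ?_
        have hkn : k ≤ n := Nat.lt_succ_iff.1 (mem_range.1 hk)
        rw [euler_coeff k a b d s p hs fun i hi => hd i (hi.trans hkn), mul_assoc, sum_mul]
        refine congrArg _ (sum_congr rfl fun i hi => ?_)
        rw [Nat.add_sub_cancel' (Nat.lt_succ_iff.1 (mem_range.1 hi))]
    _ = (d - a - 1) * (d - b - 1) * ∑ i ∈ range (n + 1), ∑ m ∈ range (n + 1 - i),
        u i * (poch s m / m.factorial) * v (i + m) := by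
        rw [sum_range_diag_flip (n + 1)
          (fun i m => u i * (poch s m / m.factorial) * v (i + m))]
    _ = _ := by
        rw [mul_assoc _ ((e - c - 1) * (f - c - 1)),
          mul_sum (range (n + 1)) _ ((e - c - 1) * (f - c - 1))]
        refine congrArg _ (sum_congr rfl fun i hi => ?_)
        have hin : i ≤ n := Nat.lt_succ_iff.1 (mem_range.1 hi)
        have key := sum_reversed_saal i (n - i) n c e f q s (by omega) hef he hf
        rw [show n + 1 - i = n - i + 1 by omega]
        simp only [mul_assoc (u i)]
        rw [← mul_sum, mul_left_comm, ← key]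

theorem poch_add_one_div {z : ℂ} {k : ℕ} (hz : z ≠ 0) (hk : poch z k ≠ 0) :
    poch (z + 1) k / poch z k = (z + k) / z := by
  rw [div_eq_div_iff hk hz, mul_comm, ← poch_succ_left, poch_succ, mul_comm]

theorem poch_sub_eq_div {z : ℂ} {n k : ℕ} (hkn : k ≤ n) (hk : poch z k ≠ 0) :
    poch (z + k) (n - k) = poch z n / poch z k := by
  rw [eq_div_iff hk, mul_comm, ← poch_add, Nat.add_sub_cancel' hkn]

theorem poch_reflect_sub {z : ℂ} {n k : ℕ} (hkn : k ≤ n) (hk : poch (1 - z - n) k ≠ 0) :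
    poch z (n - k) = (-1) ^ (n - k) * (poch (1 - z - n) n / poch (1 - z - n) k) := by
  rw [← poch_sub_eq_div hkn hk, show 1 - z - n + (k : ℂ) = 1 - z - (n - k : ℕ) by
    rw [Nat.cast_sub hkn]; ring, poch_reflect, ← mul_assoc, ← mul_pow]
  simp

theorem hypTerm_eq_sum {n : ℕ} {a b c d e f p q : ℂ} (hp0 : p ≠ 0) (hq0 : q ≠ 0)
    (he : ∀ k ≤ n, poch e k ≠ 0) (hf : ∀ k ≤ n, poch f k ≠ 0) (hp : ∀ k ≤ n, poch p k ≠ 0)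
    (hq : ∀ k ≤ n, poch q k ≠ 0) :
    hypTerm [a, b, c, p + 1, q + 1] [d, e, f, p, q] n 1 * (p * q) * (poch e n * poch f n) =
      ∑ k ∈ range (n + 1), poch a k * poch b k * (p + k) / (k.factorial * poch d k) *
        (poch c k * poch (-(n : ℂ)) k * (q + k) *
          (poch (e + k) (n - k) * poch (f + k) (n - k))) := by
  rw [hypTerm, sum_mul, sum_mul]
  refine sum_congr rfl fun k hk => ?_
  have hkn : k ≤ n := Nat.lt_succ_iff.1 (mem_range.1 hk)
  have e1 := poch_add_one_div hp0 (hp k hkn)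
  have e2 := poch_add_one_div hq0 (hq k hkn)
  rw [eq_div_iff hp0] at e1
  rw [eq_div_iff hq0] at e2
  rw [poch_sub_eq_div hkn (he k hkn), poch_sub_eq_div hkn (hf k hkn), ← e1, ← e2]
  simp only [List.map_cons, List.map_nil, List.prod_cons, List.prod_nil, one_pow]
  ring

theorem poch_sub_mul_poch_sub {g h : ℂ} {n k : ℕ} (hkn : k ≤ n) (hg : poch (1 - g - n) k ≠ 0)
    (hh : poch (1 - h - n) k ≠ 0) :
    poch (1 - g - n + k) (n - k) * poch (1 - h - n + k) (n - k) =
      poch g (n - k) * poch h (n - k) := by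
  rw [poch_reflect_sub hkn hg, poch_reflect_sub hkn hh, ← poch_sub_eq_div hkn hg,
    ← poch_sub_eq_div hkn hh, mul_mul_mul_comm, ← mul_pow]
  simp

/-- The auxiliary parameter `α` of the transformed series. -/
theorem alpha_transform {n a b c d e f q α δ : ℂ} (hsaal : d + e + f - a - b - c + n = 3)
    (hB : (c - q) * (d - a - b - 1) ≠ 0)
    (hδd : (e - c - 1) * (f - c - 1) - (c - q) * (d - a - b - 1) ≠ 0)
    (hcδ : (c - δ) * (a + b - d + 1) ≠ 0)
    (hδ : δ * ((e - c - 1) * (f - c - 1) - (c - q) * (d - a - b - 1)) =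
      q * ((e - c - 1) * (f - c - 1)) + n * ((c - q) * (d - a - b - 1)))
    (hα : α * ((c - q) * (d - a - b - 1)) = q * ((e - c - 1) * (f - c - 1))) :
    δ * (2 + c - e - n - c - 1) * (2 + c - f - n - c - 1) / ((c - δ) * (a + b - d + 1)) =
      1 - (α + 1) - n := by
  set s := d - a - b - 1 with hs
  set A := (e - c - 1) * (f - c - 1) with hA
  have hxy : (1 - e - n) * (1 - f - n) = A - (c + n) * s := by
    rw [hA, hs, show f = 3 - n - d - e + a + b + c by linear_combination hsaal]
    ring
  have hcδ' : (c - δ) * (A - (c - q) * s) = (c - q) * ((1 - e - n) * (1 - f - n)) := by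
    rw [hxy]
    linear_combination -hδ
  rw [div_eq_iff hcδ, show a + b - d + 1 = -s by rw [hs]; ring]
  refine mul_right_cancel₀ (mul_ne_zero hB hδd) ?_
  linear_combination (1 - e - n) * (1 - f - n) * ((c - q) * s) * hδ -
    (α + n) * ((c - q) * s) * s * hcδ' - (1 - e - n) * (1 - f - n) * s * (c - q) * hα

end SaalschutzTransform

theorem remark_1R12P2 (n : ℕ) (a b c d e f p q : ℂ)
    (hsaal : d + e + f - a - b - c + (n : ℂ) = 3)
    (hαd : (c - q) * (d - a - b - 1) ≠ 0)
    (hγd : a * b + p * (d - a - b - 1) ≠ 0)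
    (hδd : (e - c - 1) * (f - c - 1) - (c - q) * (d - a - b - 1) ≠ 0)
    (γ δ : ℂ)
    (hγ : γ = p * (d - a - 1) * (d - b - 1) / (a * b + p * (d - a - b - 1)))
    (hδ : δ = (q * (e - c - 1) * (f - c - 1) + (n : ℂ) * (c - q) * (d - a - b - 1)) /
        ((e - c - 1) * (f - c - 1) - (c - q) * (d - a - b - 1)))
    (hαd' : (c - δ) * (a + b - d + 1) ≠ 0)
    (hnd : ∀ z ∈ [d, e, f, p, q, 2 + c - e - (n : ℂ), 2 + c - f - (n : ℂ), γ, δ,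
        q * (e - c - 1) * (f - c - 1) / ((c - q) * (d - a - b - 1)),
        δ * (1 - e - (n : ℂ)) * (1 - f - (n : ℂ)) / ((c - δ) * (a + b - d + 1))],
      ∀ k ≤ n, poch z k ≠ 0) :
    Ftilde n a b c d e f p q
      = (-1) ^ n *
        Ftilde n (d - a - 1) (d - b - 1) c d (2 + c - e - (n : ℂ)) (2 + c - f - (n : ℂ)) γ δ := by
  rcases Nat.eq_zero_or_pos n with rfl | hn
  · simp [Ftilde, hypTerm, poch_zero]
  have hne : ∀ {z : ℂ}, (∀ k ≤ n, poch z k ≠ 0) → z ≠ 0 := fun {z} h => by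
    simpa [poch_succ, poch_zero] using h 1 hn
  have hlast : ∀ {z : ℂ}, poch z n ≠ 0 → 1 - z - n ≠ 0 := fun {z} h h0 => by
    obtain ⟨m, rfl⟩ := Nat.exists_eq_succ_of_ne_zero hn.ne'
    refine h ?_
    rw [Nat.succ_eq_add_one, poch_succ, mul_eq_zero]
    right
    push_cast at h0
    linear_combination -h0
  simp only [List.forall_mem_cons, List.not_mem_nil, false_imp_iff, implies_true, and_true] at hnd
  obtain ⟨hd, he, hf, hp, hq, he', hf', hγn, hδn, -⟩ := hnd
  have hxx := hlast (he n le_rfl)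
  have hyy := hlast (hf n le_rfl)
  have hp0 := hne hp
  have hq0 := hne hq
  have hγ0 := hne hγn
  have hδ0 := hne hδn
  have hx0 : d - a - 1 ≠ 0 := fun h => hγ0 (by rw [hγ, h]; simp)
  have hy0 : d - b - 1 ≠ 0 := fun h => hγ0 (by rw [hγ, h]; simp)
  have key := sum_euler_transform n a b c d e f p q (d - a - b - 1) hd (by ring)
    (by linear_combination hsaal) hxx hyy
  set A := (e - c - 1) * (f - c - 1) with hA
  set B := (c - q) * (d - a - b - 1) with hB
  have hH0 : q * A + n * B ≠ 0 := fun h => hδ0 (by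
    rw [hδ, show q * (e - c - 1) * (f - c - 1) + n * (c - q) * (d - a - b - 1) = q * A + n * B by
      rw [hA, hB]; ring, h]; simp)
  have hδ' : δ * (A - B) = q * A + n * B := by
    rw [hδ, div_mul_cancel₀ _ hδd, hA, hB]; ring
  have hγ' : γ * (a * b + p * (d - a - b - 1)) = p * ((d - a - 1) * (d - b - 1)) := by
    rw [hγ, div_mul_cancel₀ _ hγd]; ring
  set α := q * (e - c - 1) * (f - c - 1) / B with hαdef
  have hαB : α * B = q * A := by rw [hαdef, div_mul_cancel₀ _ hαd, hA]; ring
  set α' := δ * (2 + c - e - n - c - 1) * (2 + c - f - n - c - 1) /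
    ((c - δ) * (d - (d - a - 1) - (d - b - 1) - 1)) with hα'def
  have hα' : α' = 1 - (α + 1) - n := by
    rw [hα'def, show d - (d - a - 1) - (d - b - 1) - 1 = a + b - d + 1 by ring]
    exact alpha_transform hsaal hαd hδd hαd' hδ' hαB
  have h1 := hypTerm_eq_sum (a := a) (b := b) (c := c) (d := d) hp0 hq0 he hf hp hq
  have h2 : hypTerm [d - a - 1, d - b - 1, c, γ + 1, δ + 1]
      [d, 2 + c - e - n, 2 + c - f - n, γ, δ] n 1 *
      (p * ((d - a - 1) * (d - b - 1)) * (q * A + n * B)) *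
      (poch (2 + c - e - n) n * poch (2 + c - f - n) n) =
      ∑ k ∈ Finset.range (n + 1), poch (d - a - 1) k * poch (d - b - 1) k *
        (p * ((d - a - 1) * (d - b - 1)) + k * (a * b + p * (d - a - b - 1))) /
          (k.factorial * poch d k) *
      (poch c k * poch (-(n : ℂ)) k * (q * A + n * B + k * (A - B)) *
        (poch (e - c - 1) (n - k) * poch (f - c - 1) (n - k))) := by
    have h := hypTerm_eq_sum (a := d - a - 1) (b := d - b - 1) (c := c) (d := d) hγ0 hδ0 he' hf'
      hγn hδn
    rw [← hγ', ← hδ', show γ * (a * b + p * (d - a - b - 1)) * (δ * (A - B)) =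
      γ * δ * ((a * b + p * (d - a - b - 1)) * (A - B)) by ring, ← mul_assoc _ (γ * δ),
      mul_right_comm, h, Finset.sum_mul]
    refine Finset.sum_congr rfl fun k hk => ?_
    have hkn : k ≤ n := Nat.lt_succ_iff.1 (Finset.mem_range.1 hk)
    have ee : 2 + c - e - (n : ℂ) = 1 - (e - c - 1) - n := by ring
    have ef : 2 + c - f - (n : ℂ) = 1 - (f - c - 1) - n := by ring
    rw [ee, ef, poch_sub_mul_poch_sub hkn (by rw [← ee]; exact he' k hkn)
      (by rw [← ef]; exact hf' k hkn)]
    ring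
  rw [← h1, ← h2] at key
  have hα1 : α * poch (α + 1) n = poch α n * (α + n) := by rw [← poch_succ_left, poch_succ]
  have hsign : ((-1 : ℂ) ^ n) * (-1) ^ n = 1 := by rw [← mul_pow]; simp
  have hprefactor : poch (α + 1) n * (q * A) = poch α n * (q * A + n * B) := by
    linear_combination B * hα1 - (poch (α + 1) n - poch α n) * hαB
  simp only [Ftilde]
  rw [← hB, ← hαdef, ← hα'def, hα', poch_reflect]
  set F₁ := hypTerm [a, b, c, p + 1, q + 1] [d, e, f, p, q] n 1
  set F₂ := hypTerm [d - a - 1, d - b - 1, c, γ + 1, δ + 1]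
      [d, 2 + c - e - n, 2 + c - f - n, γ, δ] n 1
  have key' : F₂ * (q * A + n * B) * (poch (2 + c - e - n) n * poch (2 + c - f - n) n) =
      A * (F₁ * q * (poch e n * poch f n)) := by
    refine mul_left_cancel₀ (mul_ne_zero hp0 (mul_ne_zero hx0 hy0)) ?_
    linear_combination key
  refine mul_left_cancel₀ hH0 ?_
  linear_combination -poch d n * F₁ * poch e n * poch f n * hprefactor -
    poch d n * poch (α + 1) n * key' -
    (q * A + n * B) * poch d n * poch (2 + c - e - n) n * poch (2 + c - f - n) n *
      poch (α + 1) n * F₂ * hsign
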